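/- (Theorem 2.4.) Let ρ > 0 and Π_ρ = [0,1] × [0,ρ]³ × [−ρ,0]. Assume hypotheses (a), (b), (c) of Theorem 2.2 (f continuous on Π_ρ with f ≥ δ̲_ρ ≥ 0 there, H continuous bounded with H ≥ η̲_ρ ≥ 0 on ∂K_ρ, and η̲_ρ + ∫₀¹ δ̲_ρ(s) ds > 0), and in addition: (d) there is a continuous δ̄_ρ : [0,1] → [0,∞) with f(t,u,v,w,z) ≤ δ̄_ρ(t) on Π_ρ; (e) there is η̄_ρ ≥ 0 with H[u] ≤ η̄_ρ for every u ∈ ∂K_ρ. Then any eigenvalue λ_ρ > 0 obtained in Theorem 2.2, with eigenfunction u_ρ ∈ ∂K_ρ satisfying the perturbed Hammerstein integral equation, satisfies ρ / ( η̄_ρ + ∫₀¹ δ̄_ρ(s) ds ) ≤ λ_ρ ≤ ρ / ( η̲_ρ + ∫₀¹ δ̲_ρ(s) ds ). -/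

import Mathlib

open Set MeasureTheory Filter Topology

/-- The Green's function `k(t,s) = (1/6)(3t²s − t³)` for `s ≥ t`,
`k(t,s) = (1/6)(3s²t − s³)` for `s ≤ t`. -/
noncomputable def kern (t s : ℝ) : ℝ :=
  if t ≤ s then (3 * t ^ 2 * s - t ^ 3) / 6 else (3 * s ^ 2 * t - s ^ 3) / 6

/-- `γ(t) = (1/6)(3t² − t³)`. -/
noncomputable def gam (t : ℝ) : ℝ := (3 * t ^ 2 - t ^ 3) / 6

/-- The sup norm over `[0,1]`: `‖w‖_∞ = sup_{t∈[0,1]} |w(t)|`. -/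
noncomputable def supN (w : ℝ → ℝ) : ℝ := ⨆ t : Icc (0:ℝ) 1, |w ↑t|

/-- The `C³[0,1]` norm `‖u‖₃ = max_{j=0,…,3} ‖u⁽ʲ⁾‖_∞`. -/
noncomputable def norm3 (u : ℝ → ℝ) : ℝ :=
  max (max (supN u) (supN (deriv u))) (max (supN (deriv^[2] u)) (supN (deriv^[3] u)))

/-- The cone `K = {u ∈ C³[0,1] : u, u′, u″, −u‴ ≥ 0 on [0,1]}`, where elements of
`C³[0,1]` are represented by three times continuously differentiable functions on `ℝ`. -/
def coneK : Set (ℝ → ℝ) :=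
  {u | ContDiff ℝ 3 u ∧ ∀ t ∈ Icc (0:ℝ) 1,
    0 ≤ u t ∧ 0 ≤ deriv u t ∧ 0 ≤ deriv^[2] u t ∧ 0 ≤ -(deriv^[3] u t)}

/-- `K̄_ρ = {u ∈ K : ‖u‖₃ ≤ ρ}`. -/
def Kbar (ρ : ℝ) : Set (ℝ → ℝ) := {u ∈ coneK | norm3 u ≤ ρ}

/-- `∂K_ρ = {u ∈ K : ‖u‖₃ = ρ}`. -/
def Kbdry (ρ : ℝ) : Set (ℝ → ℝ) := {u ∈ coneK | norm3 u = ρ}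

/-- `Π_ρ = [0,1] × [0,ρ]³ × [−ρ,0]`. -/
def PiSet (ρ : ℝ) : Set (ℝ × ℝ × ℝ × ℝ × ℝ) :=
  {p | p.1 ∈ Icc (0:ℝ) 1 ∧ p.2.1 ∈ Icc 0 ρ ∧ p.2.2.1 ∈ Icc 0 ρ ∧
       p.2.2.2.1 ∈ Icc 0 ρ ∧ p.2.2.2.2 ∈ Icc (-ρ) 0}

/-- The operator `Tu(t) = γ(t)H[u] + ∫₀¹ k(t,s) f(s, u(s), u′(s), u″(s), u‴(s)) ds`. -/
noncomputable def Toper (f : ℝ × ℝ × ℝ × ℝ × ℝ → ℝ) (H : (ℝ → ℝ) → ℝ) (u : ℝ → ℝ) :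
    ℝ → ℝ :=
  fun t => gam t * H u +
    ∫ s in (0:ℝ)..1, kern t s * f (s, u s, deriv u s, deriv^[2] u s, deriv^[3] u s)

/-- Continuity of a functional `H` on a subset `S` of `C³[0,1]` with respect to `‖·‖₃`. -/
def ContOn3 (H : (ℝ → ℝ) → ℝ) (S : Set (ℝ → ℝ)) : Prop :=
  ∀ u ∈ S, ∀ ε > (0:ℝ), ∃ δ > (0:ℝ), ∀ v ∈ S, norm3 (u - v) < δ → |H u - H v| < ε

/-- Boundedness of a functional `H` on a subset `S` of `C³[0,1]`. -/
def BddOn3 (H : (ℝ → ℝ) → ℝ) (S : Set (ℝ → ℝ)) : Prop :=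
  ∃ M : ℝ, ∀ u ∈ S, |H u| ≤ M

/-- The moment `∫₀ᵗ sⁿ g(s) ds`. -/
noncomputable def moment (g : ℝ → ℝ) (n : ℕ) (t : ℝ) : ℝ := ∫ s in (0:ℝ)..t, s ^ n * g s

theorem hasDerivAt_moment {g : ℝ → ℝ} (hg : Continuous g) (n : ℕ) (t : ℝ) :
    HasDerivAt (moment g n) (t ^ n * g t) t :=
  have hc : Continuous fun s => s ^ n * g s := by fun_prop
  intervalIntegral.integral_hasDerivAt_right (hc.intervalIntegrable _ _)
    (hc.stronglyMeasurableAtFilter _ _) hc.continuousAt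

theorem moment_zero_right (g : ℝ → ℝ) (n : ℕ) : moment g n 0 = 0 := by simp [moment]

theorem moment_sub {g : ℝ → ℝ} (hg : Continuous g) (n : ℕ) (a b : ℝ) :
    moment g n b - moment g n a = ∫ s in a..b, s ^ n * g s := by
  have hc : Continuous fun s => s ^ n * g s := by fun_prop
  exact intervalIntegral.integral_interval_sub_left (hc.intervalIntegrable _ _)
    (hc.intervalIntegrable _ _)

theorem moment_increment_bounds {g : ℝ → ℝ} (hg : Continuous g) (hg0 : ∀ s, 0 ≤ g s) (n : ℕ)
    {a b : ℝ} (ha : 0 ≤ a) (hab : a ≤ b) (hb : b ≤ 1) :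
    0 ≤ moment g n b - moment g n a ∧
      moment g n b - moment g n a ≤ moment g 0 b - moment g 0 a := by
  rw [moment_sub hg, moment_sub hg]
  constructor
  · exact intervalIntegral.integral_nonneg hab fun s hs =>
      mul_nonneg (pow_nonneg (ha.trans hs.1) n) (hg0 s)
  · refine intervalIntegral.integral_mono_on hab (Continuous.intervalIntegrable (by fun_prop) _ _)
      (Continuous.intervalIntegrable (by fun_prop) _ _) fun s hs => ?_
    rw [pow_zero]
    exact mul_le_mul_of_nonneg_right (pow_le_one₀ (ha.trans hs.1) (hs.2.trans hb)) (hg0 s)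

theorem moment_bounds {g : ℝ → ℝ} (hg : Continuous g) (hg0 : ∀ s, 0 ≤ g s) (n : ℕ)
    {t : ℝ} (ht : t ∈ Icc (0:ℝ) 1) :
    0 ≤ moment g n t ∧ moment g n t ≤ moment g 0 t := by
  simpa only [moment_zero_right, sub_zero] using
    moment_increment_bounds hg hg0 n le_rfl ht.1 ht.2

/-- The solution of `deriv^[4] w = g` under the boundary conditions encoded by `kern` and `gam`,
written through moments of `g`, with `h` the coefficient of `gam`. -/
noncomputable def kernSol (g : ℝ → ℝ) (h t : ℝ) : ℝ :=
  gam t * h + (t / 2 * moment g 2 t - moment g 3 t / 6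
    + t ^ 2 / 2 * (moment g 1 1 - moment g 1 t) - t ^ 3 / 6 * (moment g 0 1 - moment g 0 t))

theorem gam_mul_add_integral_kern {g : ℝ → ℝ} (hg : Continuous g) (h : ℝ) {t : ℝ}
    (ht : t ∈ Icc (0:ℝ) 1) :
    gam t * h + ∫ s in (0:ℝ)..1, kern t s * g s = kernSol g h t := by
  have left : EqOn (fun s => kern t s * g s)
      (fun s => t / 2 * (s ^ 2 * g s) - 1 / 6 * (s ^ 3 * g s)) (uIcc 0 t) := by
    intro s hs
    rw [uIcc_of_le ht.1] at hs
    simp only [kern]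
    split_ifs with hts
    · obtain rfl : t = s := le_antisymm hts hs.2
      ring
    · ring
  have right : EqOn (fun s => kern t s * g s)
      (fun s => t ^ 2 / 2 * (s ^ 1 * g s) - t ^ 3 / 6 * (s ^ 0 * g s)) (uIcc t 1) := by
    intro s hs
    rw [uIcc_of_le ht.2] at hs
    simp only [kern, if_pos hs.1]
    ring
  have hi : ∀ (c : ℝ) (n : ℕ) (a b : ℝ),
      IntervalIntegrable (fun s => c * (s ^ n * g s)) volume a b :=
    fun c n a b => Continuous.intervalIntegrable (by fun_prop) a b
  have il : IntervalIntegrable (fun s => kern t s * g s) volume 0 t :=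
    ((hi _ _ _ _).sub (hi _ _ _ _)).congr (left.symm.mono uIoc_subset_uIcc)
  have ir : IntervalIntegrable (fun s => kern t s * g s) volume t 1 :=
    ((hi _ _ _ _).sub (hi _ _ _ _)).congr (right.symm.mono uIoc_subset_uIcc)
  rw [← intervalIntegral.integral_add_adjacent_intervals il ir,
    intervalIntegral.integral_congr left, intervalIntegral.integral_congr right,
    intervalIntegral.integral_sub (hi _ _ _ _) (hi _ _ _ _),
    intervalIntegral.integral_sub (hi _ _ _ _) (hi _ _ _ _)]
  simp only [intervalIntegral.integral_const_mul]
  rw [← moment_sub hg, ← moment_sub hg, ← moment_sub hg, ← moment_sub hg,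
    moment_zero_right, moment_zero_right]
  unfold kernSol
  ring

theorem hasDerivAt_kernSol {g : ℝ → ℝ} (hg : Continuous g) (h t : ℝ) :
    HasDerivAt (kernSol g h) ((t - t ^ 2 / 2) * h + (moment g 2 t / 2
      + t * (moment g 1 1 - moment g 1 t) - t ^ 2 / 2 * (moment g 0 1 - moment g 0 t))) t := by
  have m := hasDerivAt_moment hg
  have hid := hasDerivAt_id' t
  have hp := fun n : ℕ => hasDerivAt_pow n t
  refine HasDerivAt.congr_deriv ((((((hp 2).const_mul 3).sub (hp 3)).div_const 6).mul_const h).add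
    (((((hid.div_const 2).mul (m 2 t)).sub ((m 3 t).div_const 6)).add
      (((hp 2).div_const 2).mul ((m 1 t).const_sub (moment g 1 1)))).sub
      (((hp 3).div_const 6).mul ((m 0 t).const_sub (moment g 0 1))))) ?_
  push_cast
  ring

theorem hasDerivAt_deriv_kernSol {g : ℝ → ℝ} (hg : Continuous g) (h t : ℝ) :
    HasDerivAt (fun t => (t - t ^ 2 / 2) * h + (moment g 2 t / 2
      + t * (moment g 1 1 - moment g 1 t) - t ^ 2 / 2 * (moment g 0 1 - moment g 0 t)))
      ((1 - t) * h + ((moment g 1 1 - moment g 1 t) - t * (moment g 0 1 - moment g 0 t))) t := by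
  have m := hasDerivAt_moment hg
  have hid := hasDerivAt_id' t
  have hp := hasDerivAt_pow 2 t
  refine HasDerivAt.congr_deriv (((hid.sub (hp.div_const 2)).mul_const h).add
    ((((m 2 t).div_const 2).add (hid.mul ((m 1 t).const_sub (moment g 1 1)))).sub
      ((hp.div_const 2).mul ((m 0 t).const_sub (moment g 0 1))))) ?_
  push_cast
  ring

theorem hasDerivAt_deriv_deriv_kernSol {g : ℝ → ℝ} (hg : Continuous g) (h t : ℝ) :
    HasDerivAt (fun t => (1 - t) * h
      + ((moment g 1 1 - moment g 1 t) - t * (moment g 0 1 - moment g 0 t)))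
      (-(h + (moment g 0 1 - moment g 0 t))) t := by
  have m := hasDerivAt_moment hg
  have hid := hasDerivAt_id' t
  refine HasDerivAt.congr_deriv (((hid.const_sub 1).mul_const h).add
    (((m 1 t).const_sub (moment g 1 1)).sub (hid.mul ((m 0 t).const_sub (moment g 0 1))))) ?_
  ring

theorem deriv_eq_of_eqOn_Icc {F G G' : ℝ → ℝ} (hF : Differentiable ℝ F)
    (hG : ∀ t, HasDerivAt G (G' t) t) {c : ℝ}
    (h : ∀ t ∈ Icc (0:ℝ) 1, F t = c * G t) :
    ∀ t ∈ Icc (0:ℝ) 1, deriv F t = c * G' t := by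
  intro t ht
  exact ((uniqueDiffOn_Icc zero_lt_one) t ht).eq_deriv _ (hF t).hasDerivAt.hasDerivWithinAt
    (((hG t).const_mul c).hasDerivWithinAt.congr h (h t ht))

theorem abs_le_supN {w : ℝ → ℝ} (hw : Continuous w) {t : ℝ} (ht : t ∈ Icc (0:ℝ) 1) :
    |w t| ≤ supN w := by
  have hb : BddAbove (range fun t : Icc (0:ℝ) 1 => |w t|) :=
    (isCompact_range (by fun_prop)).bddAbove
  exact le_ciSup hb ⟨t, ht⟩

theorem supN_le {w : ℝ → ℝ} {c : ℝ} (h : ∀ t ∈ Icc (0:ℝ) 1, |w t| ≤ c) : supN w ≤ c :=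
  haveI : Nonempty (Icc (0:ℝ) 1) := ⟨⟨0, by simp⟩⟩
  ciSup_le fun t => h t t.2

/-- The jet of an element of `∂K_ρ` takes values in `Π_ρ`. -/
theorem jet_mem_PiSet {ρ : ℝ} {u : ℝ → ℝ} (hu : u ∈ Kbdry ρ) (h1 : Continuous (deriv u))
    (h2 : Continuous (deriv^[2] u)) (h3 : Continuous (deriv^[3] u)) {s : ℝ}
    (hs : s ∈ Icc (0:ℝ) 1) :
    (s, u s, deriv u s, deriv^[2] u s, deriv^[3] u s) ∈ PiSet ρ := by
  obtain ⟨⟨hc, hK⟩, hn⟩ := hu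
  obtain ⟨k0, k1, k2, k3⟩ := hK s hs
  have hle : norm3 u ≤ ρ := hn.le
  simp only [norm3, max_le_iff] at hle
  obtain ⟨⟨n0, n1⟩, n2, n3⟩ := hle
  have b0 := (abs_le_supN hc.continuous hs).trans n0
  have b1 := (abs_le_supN h1 hs).trans n1
  have b2 := (abs_le_supN h2 hs).trans n2
  have b3 := (abs_le_supN h3 hs).trans n3
  exact ⟨hs, ⟨k0, (abs_le.1 b0).2⟩, ⟨k1, (abs_le.1 b1).2⟩, ⟨k2, (abs_le.1 b2).2⟩,
    (abs_le.1 b3).1, neg_nonneg.1 k3⟩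

/-- If `u` in the cone is `c` times `kernSol g h` on `[0,1]`, its norm is attained by the third
derivative at `0`. -/
theorem norm3_eq_of_eq_kernSol {g : ℝ → ℝ} (hg : Continuous g) (hg0 : ∀ s, 0 ≤ g s) {h c : ℝ}
    (hh : 0 ≤ h) (hc : 0 ≤ c) {u : ℝ → ℝ} (hu : u ∈ coneK) (hd0 : Differentiable ℝ u)
    (hd1 : Differentiable ℝ (deriv u)) (hd2 : Differentiable ℝ (deriv^[2] u))
    (hc3 : Continuous (deriv^[3] u)) (heq : ∀ t ∈ Icc (0:ℝ) 1, u t = c * kernSol g h t) :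
    norm3 u = c * (h + moment g 0 1) := by
  have e1 := deriv_eq_of_eqOn_Icc hd0 (hasDerivAt_kernSol hg h) heq
  have e2 := deriv_eq_of_eqOn_Icc hd1 (hasDerivAt_deriv_kernSol hg h) e1
  have e3 := deriv_eq_of_eqOn_Icc (F := deriv (deriv u)) hd2
    (hasDerivAt_deriv_deriv_kernSol hg h) e2
  have key : ∀ x, 0 ≤ c * x → x ≤ h + moment g 0 1 →
      |c * x| ≤ c * (h + moment g 0 1) := fun x h0 hx => by
    rw [abs_of_nonneg h0]
    exact mul_le_mul_of_nonneg_left hx hc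
  have sq : ∀ t ∈ Icc (0:ℝ) 1, 0 ≤ t ^ 2 ∧ t ^ 2 ≤ t ∧ 0 ≤ t ^ 3 ∧ t ^ 3 ≤ t ^ 2 :=
    fun t ht => ⟨sq_nonneg t, by nlinarith [ht.1, ht.2], pow_nonneg ht.1 3,
      pow_le_pow_of_le_one ht.1 ht.2 (by norm_num)⟩
  apply le_antisymm
  · refine max_le (max_le (supN_le fun t ht => ?_) (supN_le fun t ht => ?_))
      (max_le (supN_le fun t ht => ?_) (supN_le fun t ht => ?_))
    all_goals
      obtain ⟨k0, k1, k2, k3⟩ := hu.2 t ht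
      obtain ⟨s1, s2, s3, s4⟩ := sq t ht
      have a0 := moment_bounds hg hg0 0 ht
      have a1 := moment_bounds hg hg0 1 ht
      have a2 := moment_bounds hg hg0 2 ht
      have a3 := moment_bounds hg hg0 3 ht
      have i0 := moment_increment_bounds hg hg0 0 ht.1 ht.2 le_rfl
      have i1 := moment_increment_bounds hg hg0 1 ht.1 ht.2 le_rfl
      have t0 := ht.1
      have t1 := ht.2
    · rw [heq t ht] at k0 ⊢
      refine key _ k0 ?_
      unfold kernSol gam
      have p1 : (3 * t ^ 2 - t ^ 3) / 6 * h ≤ 1 * h :=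
        mul_le_mul_of_nonneg_right (by linarith) hh
      have p2 : t / 2 * moment g 2 t ≤ 1 * moment g 2 t :=
        mul_le_mul_of_nonneg_right (by linarith) a2.1
      have p3 : t ^ 2 / 2 * (moment g 1 1 - moment g 1 t) ≤ 1 * (moment g 1 1 - moment g 1 t) :=
        mul_le_mul_of_nonneg_right (by linarith) i1.1
      have p4 : 0 ≤ t ^ 3 / 6 * (moment g 0 1 - moment g 0 t) :=
        mul_nonneg (by linarith) i0.1
      linarith
    · rw [e1 t ht] at k1 ⊢
      refine key _ k1 ?_
      have p1 : (t - t ^ 2 / 2) * h ≤ 1 * h := mul_le_mul_of_nonneg_right (by linarith) hh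
      have p3 : t * (moment g 1 1 - moment g 1 t) ≤ 1 * (moment g 1 1 - moment g 1 t) :=
        mul_le_mul_of_nonneg_right (by linarith) i1.1
      have p4 : 0 ≤ t ^ 2 / 2 * (moment g 0 1 - moment g 0 t) :=
        mul_nonneg (by linarith) i0.1
      linarith
    · have e := e2 t ht
      change deriv^[2] u t = _ at e
      rw [e] at k2 ⊢
      refine key _ k2 ?_
      have p1 : 0 ≤ t * h := mul_nonneg t0 hh
      have p4 : 0 ≤ t * (moment g 0 1 - moment g 0 t) := mul_nonneg t0 i0.1
      linarith
    · have e := e3 t ht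
      change deriv^[3] u t = _ at e
      rw [← abs_neg]
      rw [e, ← mul_neg, neg_neg] at k3 ⊢
      exact key _ k3 (by linarith)
  · have m0 : (0:ℝ) ∈ Icc (0:ℝ) 1 := by simp
    have e := e3 0 m0
    change deriv^[3] u 0 = _ at e
    rw [moment_zero_right, sub_zero] at e
    calc c * (h + moment g 0 1) = -(deriv^[3] u 0) := by rw [e]; ring
      _ ≤ |deriv^[3] u 0| := neg_le_abs _
      _ ≤ supN (deriv^[3] u) := abs_le_supN hc3 m0
      _ ≤ norm3 u := (le_max_right _ _).trans (le_max_right _ _)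

/-- Theorem 2.4: under hypotheses (a)–(e), any positive eigenvalue `λ_ρ` with
eigenfunction `u_ρ ∈ ∂K_ρ` of the perturbed Hammerstein integral equation satisfies
`ρ/(η̄_ρ + ∫₀¹ δ̄_ρ) ≤ λ_ρ ≤ ρ/(η̲_ρ + ∫₀¹ δ̲_ρ)`. -/
theorem eigenvalue_localization
    (ρ : ℝ) (hρ : 0 < ρ)
    (f : ℝ × ℝ × ℝ × ℝ × ℝ → ℝ) (hfc : ContinuousOn f (PiSet ρ))
    (δlo δhi : ℝ → ℝ)
    (hδloc : ContinuousOn δlo (Icc 0 1)) (hδlo0 : ∀ t ∈ Icc (0:ℝ) 1, 0 ≤ δlo t)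
    (hfδlo : ∀ p ∈ PiSet ρ, δlo p.1 ≤ f p)
    (hδhic : ContinuousOn δhi (Icc 0 1)) (hδhi0 : ∀ t ∈ Icc (0:ℝ) 1, 0 ≤ δhi t)
    (hfδhi : ∀ p ∈ PiSet ρ, f p ≤ δhi p.1)
    (H : (ℝ → ℝ) → ℝ) (hHc : ContOn3 H (Kbar ρ)) (hHb : BddOn3 H (Kbar ρ))
    (ηlo ηhi : ℝ) (hηlo0 : 0 ≤ ηlo) (hηhi0 : 0 ≤ ηhi)
    (hHlo : ∀ u ∈ Kbdry ρ, ηlo ≤ H u) (hHhi : ∀ u ∈ Kbdry ρ, H u ≤ ηhi)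
    (hpos : 0 < ηlo + ∫ s in (0:ℝ)..1, δlo s)
    (lam : ℝ) (hlam : 0 < lam)
    (u : ℝ → ℝ) (hu : u ∈ Kbdry ρ)
    (heq : ∀ t ∈ Icc (0:ℝ) 1, u t = lam * Toper f H u t) :
    ρ / (ηhi + ∫ s in (0:ℝ)..1, δhi s) ≤ lam ∧
    lam ≤ ρ / (ηlo + ∫ s in (0:ℝ)..1, δlo s) := by
  have hK := hu.1
  have hC : ContDiff ℝ 3 u := hK.1
  have hC1 : ContDiff ℝ 2 (deriv u) := ((contDiff_succ_iff_deriv (n := 2)).1 hC).2.2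
  have hC2 : ContDiff ℝ 1 (deriv^[2] u) := ((contDiff_succ_iff_deriv (n := 1)).1 hC1).2.2
  have hc3 : Continuous (deriv^[3] u) :=
    (((contDiff_succ_iff_deriv (n := 0)).1 hC2).2.2).continuous
  have hc0 := hC.continuous
  have hc1 := hC1.continuous
  have hc2 := hC2.continuous
  have hjet := fun s (hs : s ∈ Icc (0:ℝ) 1) => jet_mem_PiSet hu hc1 hc2 hc3 hs
  let F : ℝ → ℝ := fun s => f (s, u s, deriv u s, deriv^[2] u s, deriv^[3] u s)
  have hF : ContinuousOn F (Icc 0 1) := hfc.comp (by fun_prop) hjet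
  let g : ℝ → ℝ := IccExtend zero_le_one ((Icc (0:ℝ) 1).domRestrict F)
  have hg : Continuous g := hF.domRestrict.Icc_extend'
  have hgF : ∀ s ∈ Icc (0:ℝ) 1, g s = F s := fun s hs => IccExtend_of_mem _ _ hs
  have hg0 : ∀ s, 0 ≤ g s := fun s =>
    let p := projIcc (0:ℝ) 1 zero_le_one s
    (hδlo0 p p.2).trans (hfδlo _ (hjet p p.2))
  have hsol : ∀ t ∈ Icc (0:ℝ) 1, u t = lam * kernSol g (H u) t := by
    intro t ht
    rw [heq t ht, ← gam_mul_add_integral_kern hg (H u) ht, Toper]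
    congr 2
    refine intervalIntegral.integral_congr fun s hs => ?_
    rw [uIcc_of_le zero_le_one] at hs
    simp only [hgF s hs, F]
  have hnorm := norm3_eq_of_eq_kernSol hg hg0 (hηlo0.trans (hHlo u hu)) hlam.le hK
    (hC.differentiable (by norm_num)) (hC1.differentiable (by norm_num))
    (hC2.differentiable (by norm_num)) hc3 hsol
  rw [hu.2] at hnorm
  have hM : moment g 0 1 = ∫ s in (0:ℝ)..1, g s := by simp [moment]
  have hlo : ∫ s in (0:ℝ)..1, δlo s ≤ moment g 0 1 := by
    rw [hM]
    refine intervalIntegral.integral_mono_on zero_le_one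
      (hδloc.intervalIntegrable_of_Icc zero_le_one) (hg.intervalIntegrable _ _) fun s hs => ?_
    rw [hgF s hs]
    exact hfδlo _ (hjet s hs)
  have hhi : moment g 0 1 ≤ ∫ s in (0:ℝ)..1, δhi s := by
    rw [hM]
    refine intervalIntegral.integral_mono_on zero_le_one (hg.intervalIntegrable _ _)
      (hδhic.intervalIntegrable_of_Icc zero_le_one) fun s hs => ?_
    rw [hgF s hs]
    exact hfδhi _ (hjet s hs)
  have hl := hHlo u hu
  have hh := hHhi u hu
  rw [div_le_iff₀ (by linarith), le_div_iff₀ hpos, hnorm]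
  exact ⟨mul_le_mul_of_nonneg_left (by linarith) hlam.le,
    mul_le_mul_of_nonneg_left (by linarith) hlam.le⟩
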